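/- Let x ∈ S^{N−1} be a unit vector and let T ⊂ ℝ^N be an n-dimensional subspace orthogonal to x (i.e., T ⊥ x). Then ∫_{A ∈ ℝ^{n×N}, Ax = 0} |det(A|_T)| φ_{n×N}(A) dA = 1/vol(ℙ^n), where vol(ℙ^n) = π^{(n+1)/2}/Γ((n+1)/2) is the volume of real projective n-space, and the integral is over the codimension-n linear subspace {A : Ax = 0} ⊂ ℝ^{n×N} with respect to its Lebesgue measure weighted by the standard Gaussian density φ_{n×N}. -/

import Mathlib

open Matrix MeasureTheory
open ProbabilityTheory

theorem lint_split {n : ℕ} {E : Type*} [MeasurableSpace E] (μ : Fin (n + 1) → Measure E)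
    [∀ i, SigmaFinite (μ i)] (F : (Fin (n + 1) → E) → ENNReal) :
    ∫⁻ x, F x ∂(Measure.pi μ) =
      ∫⁻ p, F (vecCons p.1 p.2) ∂((μ 0).prod (Measure.pi fun i : Fin n => μ i.succ)) := by
  have h := (measurePreserving_piFinSuccAbove μ 0).symm
  rw [← h.lintegral_comp_emb (MeasurableEquiv.measurableEmbedding _)]
  simp_rw [MeasurableEquiv.piFinSuccAbove_symm_apply, Fin.insertNthEquiv]
  simp only [Fin.zero_succAbove, Equiv.coe_fn_mk, Fin.insertNth_zero']
  rfl

theorem lint_pi {n : ℕ} {E : Type*} [MeasurableSpace E] (μ : Fin n → Measure E)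
    [∀ i, SigmaFinite (μ i)] (f : Fin n → E → ENNReal) (hf : ∀ i, Measurable (f i)) :
    ∫⁻ x, ∏ i, f i (x i) ∂(Measure.pi μ) = ∏ i, ∫⁻ x, f i x ∂(μ i) := by
  induction n with
  | zero => simp
  | succ n ih =>
    rw [lint_split]
    simp_rw [Fin.prod_univ_succ]
    simp only [cons_val_zero, cons_val_succ]
    rw [lintegral_prod_mul (g := fun z : Fin n → E => ∏ i, f i.succ (z i))
      (hf 0).aemeasurable, ih (fun i => μ i.succ) (fun i => f i.succ) (fun i => hf _)]
    exact (Finset.measurable_prod _ fun i _ => (hf _).comp (measurable_pi_apply i)).aemeasurable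

theorem pi_wd {n : ℕ} {E : Type*} [MeasurableSpace E] (μ : Measure E)
    [SigmaFinite μ] (f : E → ENNReal) (hf : Measurable f) [SigmaFinite (μ.withDensity f)] :
    Measure.pi (fun _ : Fin n => μ.withDensity f) =
      (Measure.pi (fun _ : Fin n => μ)).withDensity (fun x => ∏ i, f (x i)) := by
  refine Measure.pi_eq fun s hs => ?_
  rw [withDensity_apply _ (MeasurableSet.univ_pi hs), Measure.restrict_pi_pi,
    lint_pi _ (fun _ => f) (fun _ => hf)]
  simp_rw [withDensity_apply _ (hs _)]

noncomputable def gam (n : ℕ) : Measure (Fin n → ℝ) := Measure.pi (fun _ => gaussianReal 0 1)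

noncomputable def gd (n : ℕ) (x : Fin n → ℝ) : ℝ :=
  (2 * Real.pi) ^ (-(n : ℝ) / 2) * Real.exp (-(∑ i, x i ^ 2) / 2)

instance (n : ℕ) : IsProbabilityMeasure (gam n) := by unfold gam; infer_instance

theorem gd_meas (n : ℕ) : Measurable (gd n) := by unfold gd; fun_prop

theorem gam_eq (n : ℕ) : gam n = volume.withDensity (fun x => ENNReal.ofReal (gd n x)) := by
  have h1 : gaussianReal 0 1 = volume.withDensity (gaussianPDF 0 1) :=
    gaussianReal_of_var_ne_zero _ one_ne_zero
  have : SigmaFinite ((volume : Measure ℝ).withDensity (gaussianPDF 0 1)) := by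
    rw [← h1]; infer_instance
  unfold gam
  rw [h1, pi_wd _ _ (measurable_gaussianPDF 0 1), ← volume_pi]
  congr 1
  ext x
  simp only [gaussianPDF]
  rw [← ENNReal.ofReal_prod_of_nonneg (fun i _ => gaussianPDFReal_nonneg _ _ _)]
  congr 1
  simp only [gaussianPDFReal, gd, Finset.prod_mul_distrib, ← Real.exp_sum]
  congr 1
  · rw [Finset.prod_const, Finset.card_univ, Fintype.card_fin, NNReal.coe_one, mul_one,
      Real.sqrt_eq_rpow, ← Real.rpow_neg (by positivity), ← Real.rpow_natCast,
      ← Real.rpow_mul (by positivity)]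
    congr 1
    ring
  · simp [Finset.sum_div, neg_div]

theorem gam_map {m n : ℕ} (U : Matrix (Fin m) (Fin n) ℝ) (hU : Uᵀ * U = 1) :
    (gam m).map (fun a => a ᵥ* U) = gam n := by
  have hmeas : Measurable (fun a : Fin m → ℝ => a ᵥ* U) := by
    refine Continuous.measurable ?_
    fun_prop
  have key : ((gam m).map (fun a => a ᵥ* U)).map (WithLp.toLp 2) = (gam n).map (WithLp.toLp 2) := by
    apply Measure.ext_of_charFun (E := EuclideanSpace ℝ (Fin n))
    ext t
    unfold gam
    rw [map_pi_eq_stdGaussian, charFun_stdGaussian, Measure.map_map (by fun_prop) hmeas]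
    have h2 := charFun_stdGaussian (E := EuclideanSpace ℝ (Fin m)) (WithLp.toLp 2 (U *ᵥ t.ofLp))
    have h3 : ‖(WithLp.toLp 2 (U *ᵥ t.ofLp) : EuclideanSpace ℝ (Fin m))‖ ^ 2 = ‖t‖ ^ 2 := by
      have e : ∀ (k : ℕ) (v : EuclideanSpace ℝ (Fin k)), ‖v‖ ^ 2 = v.ofLp ⬝ᵥ v.ofLp := by
        intro k v
        rw [EuclideanSpace.real_norm_sq_eq]; simp [dotProduct, sq]
      rw [e, e]
      simp only
      rw [dotProduct_mulVec, ← mulVec_transpose, mulVec_mulVec, hU, one_mulVec]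
    rw [← Complex.ofReal_pow, ← h3, Complex.ofReal_pow, ← h2, ← map_pi_eq_stdGaussian, charFun_apply, charFun_apply,
      integral_map (by fun_prop) (by fun_prop), integral_map (by fun_prop) (by fun_prop)]
    congr 1
    ext a
    congr 3
    simp only [Function.comp, PiLp.inner_apply, RCLike.inner_apply, conj_trivial]
    change (t.ofLp ⬝ᵥ (a ᵥ* U)) = (U *ᵥ t.ofLp) ⬝ᵥ a
    rw [dotProduct_comm, dotProduct_comm (U *ᵥ _), dotProduct_mulVec]
  have := congrArg (Measure.map (WithLp.ofLp (p := 2))) key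
  rw [Measure.map_map (by fun_prop) (by fun_prop), Measure.map_map (by fun_prop) (by fun_prop)] at this
  simp only [Function.comp_def] at this
  rw [Measure.map_map (by fun_prop) (by fun_prop)] at this
  simp only [Function.comp_def] at this
  rw [this]
  exact Measure.map_id

theorem norm_real (n : ℕ) : ∫ x : EuclideanSpace ℝ (Fin (n + 1)),
      ‖x‖ * ((2 * Real.pi) ^ (-((n + 1 : ℕ) : ℝ) / 2) * Real.exp (-‖x‖ ^ 2 / 2))
    = √2 * Real.Gamma (((n : ℝ) + 2) / 2) / Real.Gamma (((n : ℝ) + 1) / 2) := by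
  rw [integral_fun_norm_addHaar volume
    (fun y => y * ((2 * Real.pi) ^ (-((n + 1 : ℕ) : ℝ) / 2) * Real.exp (-y ^ 2 / 2)))]
  have h1 : ∫ y in Set.Ioi (0 : ℝ), y ^ (Module.finrank ℝ (EuclideanSpace ℝ (Fin (n + 1))) - 1) •
      (y * ((2 * Real.pi) ^ (-((n + 1 : ℕ) : ℝ) / 2) * Real.exp (-y ^ 2 / 2))) =
      (2 * Real.pi) ^ (-((n + 1 : ℕ) : ℝ) / 2) *
      ∫ y in Set.Ioi (0 : ℝ), y ^ ((n : ℝ) + 1) * Real.exp (-(1 / 2) * y ^ (2 : ℝ)) := by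
    rw [← integral_const_mul]
    refine setIntegral_congr_fun measurableSet_Ioi fun y hy => ?_
    have hy : 0 < y := hy
    simp only [finrank_euclideanSpace, Fintype.card_fin, Nat.add_sub_cancel, smul_eq_mul]
    rw [Real.rpow_add_one hy.ne', Real.rpow_natCast, Real.rpow_two,
      show -y ^ 2 / 2 = -(1 / 2) * y ^ 2 by ring]
    ring
  rw [h1, integral_rpow_mul_exp_neg_mul_rpow two_pos (by linarith [(n.cast_nonneg : (0:ℝ) ≤ n)]) (by norm_num)]
  simp only [finrank_euclideanSpace, Fintype.card_fin, Measure.real, EuclideanSpace.volume_ball,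
    ENNReal.ofReal_one, one_pow, one_mul, nsmul_eq_mul, smul_eq_mul]
  rw [ENNReal.toReal_ofReal (by positivity)]
  push_cast
  have hG : Real.Gamma (((n : ℝ) + 1) / 2 + 1) = ((n : ℝ) + 1) / 2 * Real.Gamma (((n : ℝ) + 1) / 2) :=
    Real.Gamma_add_one (by positivity)
  have hp : Real.Gamma (((n : ℝ) + 1) / 2) ≠ 0 := (Real.Gamma_pos_of_pos (by positivity)).ne'
  rw [hG, show (n : ℝ) + 1 + 1 = n + 2 by ring]
  have e1 : (2 * Real.pi) ^ (-((n : ℝ) + 1) / 2) = (√2 ^ (n + 1))⁻¹ * (√Real.pi ^ (n + 1))⁻¹ := by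
    rw [← mul_inv, ← mul_pow, ← Real.sqrt_mul (by norm_num), Real.sqrt_eq_rpow,
      ← Real.rpow_natCast, ← Real.rpow_mul (by positivity), ← Real.rpow_neg (by positivity)]
    congr 1
    push_cast
    ring
  have e2 : ((1 : ℝ) / 2) ^ (-((n : ℝ) + 2) / 2) = √2 ^ (n + 2) := by
    rw [one_div, Real.inv_rpow (by norm_num), ← Real.rpow_neg (by norm_num), Real.sqrt_eq_rpow,
      ← Real.rpow_natCast, ← Real.rpow_mul (by positivity)]
    congr 1
    push_cast
    ring
  rw [e1, e2]
  have : √Real.pi ≠ 0 := by positivity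
  have : √2 ≠ 0 := by positivity
  field_simp
  try ring

theorem norm_lint (n : ℕ) : ∫⁻ x, ENNReal.ofReal ‖(WithLp.toLp 2 x : EuclideanSpace ℝ (Fin (n + 1)))‖
      ∂(gam (n + 1)) =
    ENNReal.ofReal (√2 * Real.Gamma (((n : ℝ) + 2) / 2) / Real.Gamma (((n : ℝ) + 1) / 2)) := by
  have hpos : 0 < √2 * Real.Gamma (((n : ℝ) + 2) / 2) / Real.Gamma (((n : ℝ) + 1) / 2) := by
    have h1 : 0 < Real.Gamma (((n : ℝ) + 2) / 2) := Real.Gamma_pos_of_pos (by positivity)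
    have h2 : 0 < Real.Gamma (((n : ℝ) + 1) / 2) := Real.Gamma_pos_of_pos (by positivity)
    positivity
  rw [← norm_real] at hpos ⊢
  rw [ofReal_integral_eq_lintegral_ofReal]
  · rw [gam_eq, lintegral_withDensity_eq_lintegral_mul _ (gd_meas _).ennreal_ofReal (by fun_prop),
      ← (PiLp.volume_preserving_toLp (Fin (n + 1))).lintegral_comp (by fun_prop)]
    refine lintegral_congr fun x => ?_
    simp only [Pi.mul_apply]
    rw [mul_comm, ← ENNReal.ofReal_mul (norm_nonneg _), EuclideanSpace.real_norm_sq_eq]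
    rfl
  · by_contra h
    rw [integral_undef h] at hpos
    exact lt_irrefl _ hpos
  · exact Filter.Eventually.of_forall fun x => by positivity

theorem exists_U {n : ℕ} (a : Fin (n + 1) → ℝ) : ∃ U : Matrix (Fin (n + 1)) (Fin n) ℝ,
    Uᵀ * U = 1 ∧ ∀ R : Fin n → Fin (n + 1) → ℝ,
      |(Matrix.of (vecCons a R)).det| =
        ‖(WithLp.toLp 2 a : EuclideanSpace ℝ (Fin (n + 1)))‖ * |(Matrix.of R * U).det| := by
  set v : EuclideanSpace ℝ (Fin (n + 1)) := WithLp.toLp 2 a with hv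
  obtain ⟨u, hu, huv⟩ : ∃ u : EuclideanSpace ℝ (Fin (n + 1)), ‖u‖ = 1 ∧ v = ‖v‖ • u := by
    by_cases h : v = 0
    · exact ⟨EuclideanSpace.single 0 1, by simp, by simp [h]⟩
    · exact ⟨‖v‖⁻¹ • v, by simp [norm_smul, h], by rw [smul_smul, mul_inv_cancel₀ (by simpa), one_smul]⟩
  have ho : Orthonormal ℝ (({0} : Set (Fin (n + 1))).domRestrict (fun _ => u)) := by
    rw [orthonormal_iff_ite]
    rintro ⟨i, rfl⟩ ⟨j, rfl⟩
    simp only [if_true]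
    change inner ℝ u u = 1
    rw [real_inner_self_eq_norm_sq, hu, one_pow]
  obtain ⟨b, hb⟩ := ho.exists_orthonormalBasis_extension_of_card_eq (by simp)
  have hb0 : b 0 = u := hb 0 rfl
  let Q : Matrix (Fin (n + 1)) (Fin (n + 1)) ℝ := Matrix.of fun i j => b j i
  have hQ : Qᵀ * Q = 1 := by
    ext i j
    have := (orthonormal_iff_ite.1 b.orthonormal) i j
    rw [PiLp.inner_apply] at this
    simp only [RCLike.inner_apply, conj_trivial] at this
    rw [Matrix.one_apply, ← this]
    simp [Q, Matrix.mul_apply, mul_comm]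
  refine ⟨Q.submatrix id Fin.succ, ?_, fun R => ?_⟩
  · ext i j
    have := congrFun (congrFun hQ i.succ) j.succ
    simpa [Matrix.mul_apply, Matrix.one_apply] using this
  · have hdQ : |Q.det| = 1 := by
      have := congrArg Matrix.det hQ
      rw [det_mul, det_transpose, det_one, ← sq] at this
      rw [← sq_eq_sq₀ (abs_nonneg _) zero_le_one, sq_abs, this, one_pow]
    have hrow : ∀ j, (Matrix.of (vecCons a R) * Q) 0 j = if j = 0 then ‖v‖ else 0 := by
      intro j
      have h0 := (orthonormal_iff_ite.1 b.orthonormal) j 0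
      have h1 : inner ℝ (b j) v = ‖v‖ * (if j = 0 then 1 else 0) := by
        rw [← h0, hb0, ← real_inner_smul_right, ← huv]
      rw [PiLp.inner_apply] at h1
      simp only [RCLike.inner_apply, conj_trivial, mul_ite, mul_one, mul_zero] at h1
      rw [← h1]
      simp [Matrix.mul_apply, Q, hv]
    have h2 : (Matrix.of (vecCons a R)).det * Q.det =
        ‖v‖ * (Matrix.of R * Q.submatrix id Fin.succ).det := by
      rw [← det_mul, det_succ_row_zero, Finset.sum_eq_single 0]
      · rw [hrow]
        simp only [Fin.val_zero, pow_zero, one_mul, if_true]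
        congr 2
      · intro j _ hj
        rw [hrow, if_neg hj]; simp
      · simp
    have h3 := congrArg abs h2
    rwa [abs_mul, hdQ, mul_one, abs_mul, abs_norm] at h3

theorem meas_det {k l : ℕ} (U : Matrix (Fin l) (Fin k) ℝ) :
    Measurable fun R : Fin k → Fin l → ℝ => ENNReal.ofReal |(Matrix.of R * U).det| := by
  refine Measurable.ennreal_ofReal (Continuous.measurable ?_)
  refine continuous_abs.comp (Continuous.matrix_det ?_)
  exact Continuous.matrix_mul (by exact continuous_id) continuous_const

theorem meas_det' {k : ℕ} :
    Measurable fun R : Fin k → Fin k → ℝ => ENNReal.ofReal |(Matrix.of R).det| := by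
  simpa using meas_det (1 : Matrix (Fin k) (Fin k) ℝ)

theorem det_U {m n : ℕ} (U : Matrix (Fin m) (Fin n) ℝ) (hU : Uᵀ * U = 1) :
    ∫⁻ R, ENNReal.ofReal |(Matrix.of R * U).det| ∂(Measure.pi fun _ : Fin n => gam m) =
      ∫⁻ R, ENNReal.ofReal |(Matrix.of R).det| ∂(Measure.pi fun _ : Fin n => gam n) := by
  have hmeas : Measurable (fun a : Fin m → ℝ => a ᵥ* U) := by
    refine Continuous.measurable ?_
    fun_prop
  have : SigmaFinite ((gam m).map (fun a => a ᵥ* U)) := by rw [gam_map U hU]; infer_instance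
  have h : (Measure.pi fun _ : Fin n => gam m).map (fun R i => R i ᵥ* U) =
      Measure.pi fun _ : Fin n => gam n := by
    rw [Measure.pi_map_pi (fun _ => hmeas.aemeasurable), gam_map U hU]
  rw [← h, lintegral_map meas_det' (by fun_prop)]
  rfl

theorem det_main (n : ℕ) :
    ∫⁻ R, ENNReal.ofReal |(Matrix.of R).det| ∂(Measure.pi fun _ : Fin n => gam n) =
      ENNReal.ofReal (√2 ^ n * Real.Gamma (((n : ℝ) + 1) / 2) / √Real.pi) := by
  induction n with
  | zero =>
    have : √Real.pi ≠ 0 := by positivity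
    simp [← Real.Gamma_one_half_eq] at this ⊢
    rw [div_self this]; simp
  | succ n ih =>
    rw [lint_split, lintegral_prod]
    · have : ∀ a : Fin (n + 1) → ℝ, ∫⁻ R, ENNReal.ofReal |(Matrix.of (vecCons a R)).det|
          ∂(Measure.pi fun _ : Fin n => gam (n + 1)) =
          ENNReal.ofReal ‖(WithLp.toLp 2 a : EuclideanSpace ℝ (Fin (n + 1)))‖ *
          ENNReal.ofReal (√2 ^ n * Real.Gamma (((n : ℝ) + 1) / 2) / √Real.pi) := by
        intro a
        obtain ⟨U, hU, h⟩ := exists_U a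
        simp_rw [h, ENNReal.ofReal_mul (norm_nonneg _)]
        rw [lintegral_const_mul _ (meas_det U), det_U U hU, ih]
      simp_rw [this]
      have h1 : 0 < Real.Gamma (((n : ℝ) + 2) / 2) := Real.Gamma_pos_of_pos (by positivity)
      have h2 : 0 < Real.Gamma (((n : ℝ) + 1) / 2) := Real.Gamma_pos_of_pos (by positivity)
      rw [lintegral_mul_const _ (by fun_prop), norm_lint, ← ENNReal.ofReal_mul (by positivity)]
      congr 1
      push_cast
      rw [show (n : ℝ) + 1 + 1 = n + 2 by ring]
      field_simp
      ring
    · refine (meas_det'.comp ?_).aemeasurable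
      refine measurable_pi_iff.2 fun i => ?_
      refine Fin.cases ?_ (fun j => ?_) i
      · simpa using measurable_fst
      · simpa [Function.comp_def] using (measurable_pi_apply j).comp measurable_snd

theorem pi_gam (n m : ℕ) : (Measure.pi fun _ : Fin n => gam m) =
    (volume : Measure (Fin n → Fin m → ℝ)).withDensity (fun A => ENNReal.ofReal
      ((2 * Real.pi) ^ (-((n * m : ℕ) : ℝ) / 2) * Real.exp (-(∑ i, ∑ j, A i j ^ 2) / 2))) := by
  have hs : SigmaFinite ((volume : Measure (Fin m → ℝ)).withDensity
      (fun x => ENNReal.ofReal (gd m x))) := by rw [← gam_eq]; infer_instance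
  rw [gam_eq, pi_wd _ _ (gd_meas m).ennreal_ofReal, ← volume_pi]
  congr 1
  ext A
  rw [← ENNReal.ofReal_prod_of_nonneg (fun i _ => by unfold gd; positivity)]
  congr 1
  simp only [gd, Finset.prod_mul_distrib, ← Real.exp_sum]
  congr 1
  · rw [Finset.prod_const, Finset.card_univ, Fintype.card_fin, ← Real.rpow_natCast,
      ← Real.rpow_mul (by positivity)]
    congr 1
    push_cast
    ring
  · simp [Finset.sum_div, neg_div]

theorem VVt {m : ℕ} (x : Fin (m + 1) → ℝ) (hx : x ⬝ᵥ x = 1)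
    (V : Matrix (Fin (m + 1)) (Fin m) ℝ) (hV : Vᵀ * V = 1) (hVx : Vᵀ.mulVec x = 0) :
    V * Vᵀ = 1 - vecMulVec x x := by
  let Q : Matrix (Fin (m + 1)) (Fin (m + 1)) ℝ := Matrix.of fun i j => (vecCons (x i) (V i) : Fin (m + 1) → ℝ) j
  have hQ : Qᵀ * Q = 1 := by
    ext i j
    refine Fin.cases ?_ (fun i => ?_) i <;> refine Fin.cases ?_ (fun j => ?_) j
    · simpa [Q, Matrix.mul_apply, dotProduct] using hx
    · have := congrFun hVx j
      simpa [Q, Matrix.mul_apply, mulVec, dotProduct, mul_comm, Matrix.one_apply, (Fin.succ_ne_zero j).symm] using this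
    · have := congrFun hVx i
      simpa [Q, Matrix.mul_apply, mulVec, dotProduct, Matrix.one_apply] using this
    · have := congrFun (congrFun hV i) j
      simpa [Q, Matrix.mul_apply, Matrix.one_apply] using this
  have h2 : Q * Qᵀ = 1 := mul_eq_one_comm.1 hQ
  rw [← h2]
  ext i j
  simp [Q, Matrix.mul_apply, Fin.sum_univ_succ, vecMulVec_apply]

theorem integral_over_Hx (n m : ℕ) (x : Fin (m + 1) → ℝ) (hx : x ⬝ᵥ x = 1)
    (W : Matrix (Fin (m + 1)) (Fin n) ℝ) (hW : Wᵀ * W = 1) (hWx : Wᵀ.mulVec x = 0)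
    (V : Matrix (Fin (m + 1)) (Fin m) ℝ) (hV : Vᵀ * V = 1) (hVx : Vᵀ.mulVec x = 0) :
    (∫ A' : Fin n → Fin m → ℝ,
        |((Matrix.of A' * Vᵀ) * W).det| *
          ((2 * Real.pi) ^ (-((n * (m + 1) : ℕ) : ℝ) / 2) *
            Real.exp (-(∑ i, ∑ j, ((Matrix.of A' * Vᵀ) i j) ^ 2) / 2)))
      = Real.Gamma (((n : ℝ) + 1) / 2) / Real.pi ^ (((n : ℝ) + 1) / 2) := by
  have hU : (Vᵀ * W)ᵀ * (Vᵀ * W) = 1 := by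
    have : (Vᵀ * W)ᵀ * (Vᵀ * W) = Wᵀ * (V * Vᵀ) * W := by
      simp [Matrix.mul_assoc, transpose_mul]
    rw [this, VVt x hx V hV hVx, Matrix.mul_sub, Matrix.mul_vecMulVec, hWx]
    simp [hW]
  have hsum : ∀ A : Fin n → Fin m → ℝ,
      ∑ i, ∑ j, ((Matrix.of A * Vᵀ) i j) ^ 2 = ∑ i, ∑ j, A i j ^ 2 := by
    intro A
    have e : ∀ (k : ℕ) (B : Matrix (Fin n) (Fin k) ℝ), ∑ i, ∑ j, B i j ^ 2 = (B * Bᵀ).trace := by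
      intro k B
      simp [trace, Matrix.mul_apply, sq]
    rw [e, show ∑ i, ∑ j, A i j ^ 2 = _ from e m (Matrix.of A), transpose_mul, transpose_transpose,
      Matrix.mul_assoc, ← Matrix.mul_assoc Vᵀ, hV, Matrix.one_mul]
  have hpt : ∀ A : Fin n → Fin m → ℝ, |((Matrix.of A * Vᵀ) * W).det| *
          ((2 * Real.pi) ^ (-((n * (m + 1) : ℕ) : ℝ) / 2) *
            Real.exp (-(∑ i, ∑ j, ((Matrix.of A * Vᵀ) i j) ^ 2) / 2)) =
      (√2 ^ n * √Real.pi ^ n)⁻¹ * (|(Matrix.of A * (Vᵀ * W)).det| *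
          ((2 * Real.pi) ^ (-((n * m : ℕ) : ℝ) / 2) * Real.exp (-(∑ i, ∑ j, A i j ^ 2) / 2))) := by
    intro A
    have e1 : (2 * Real.pi) ^ (-((n * (m + 1) : ℕ) : ℝ) / 2) =
        (√2 ^ n * √Real.pi ^ n)⁻¹ * (2 * Real.pi) ^ (-((n * m : ℕ) : ℝ) / 2) := by
      rw [← mul_pow, ← Real.sqrt_mul (by norm_num), Real.sqrt_eq_rpow,
        ← Real.rpow_natCast, ← Real.rpow_mul (by positivity), ← Real.rpow_neg (by positivity),
        ← Real.rpow_add (by positivity)]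
      congr 1
      push_cast
      ring
    rw [hsum, e1, Matrix.mul_assoc]
    ring
  simp_rw [hpt]
  have hm := meas_det (Vᵀ * W)
  have hm2 : Measurable fun R : Fin n → Fin m → ℝ => |(Matrix.of R * (Vᵀ * W)).det| := by
    simpa using hm.ennreal_toReal
  have hm3 : Measurable fun A : Fin n → Fin m → ℝ =>
      ((2 * Real.pi) ^ (-((n * m : ℕ) : ℝ) / 2) * Real.exp (-(∑ i, ∑ j, A i j ^ 2) / 2)) := by
    fun_prop
  have hG : 0 < Real.Gamma (((n : ℝ) + 1) / 2) := Real.Gamma_pos_of_pos (by positivity)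
  have key := (det_U (Vᵀ * W) hU).trans (det_main n)
  rw [pi_gam, lintegral_withDensity_eq_lintegral_mul _ hm3.ennreal_ofReal hm] at key
  rw [integral_const_mul, integral_eq_lintegral_of_nonneg_ae
    (Filter.Eventually.of_forall fun A => by positivity) (by exact (hm2.mul hm3).aestronglyMeasurable)]
  have h4 : ∀ A : Fin n → Fin m → ℝ, ENNReal.ofReal (|(Matrix.of A * (Vᵀ * W)).det| *
          ((2 * Real.pi) ^ (-((n * m : ℕ) : ℝ) / 2) * Real.exp (-(∑ i, ∑ j, A i j ^ 2) / 2))) =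
        ((fun A : Fin n → Fin m → ℝ => ENNReal.ofReal
          ((2 * Real.pi) ^ (-((n * m : ℕ) : ℝ) / 2) * Real.exp (-(∑ i, ∑ j, A i j ^ 2) / 2))) *
        fun R : Fin n → Fin m → ℝ => ENNReal.ofReal |(Matrix.of R * (Vᵀ * W)).det|) A := by
    intro A
    rw [ENNReal.ofReal_mul (abs_nonneg _), mul_comm]
    rfl
  rw [lintegral_congr h4, key, ENNReal.toReal_ofReal (by positivity)]
  have e3 : Real.pi ^ (((n : ℝ) + 1) / 2) = √Real.pi ^ n * √Real.pi := by
    rw [← pow_succ, Real.sqrt_eq_rpow, ← Real.rpow_natCast, ← Real.rpow_mul (by positivity)]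
    congr 1
    push_cast
    ring
  rw [e3]
  field_simp
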